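/- Let d ≥ 1, let Σ be a symmetric positive definite d×d real matrix, and let x, y ∈ ℝ^d be nonzero. If w is distributed as N(0,Σ), then E[ (wᵀx)₊ (wᵀy)₊ ] = (1/(2π)) ‖Σ^{1/2}x‖ ‖Σ^{1/2}y‖ ( sin θ + (π − θ) cos θ ), where Σ^{1/2} is the symmetric positive definite square root of Σ and θ = arccos( xᵀΣy / √((xᵀΣx)(yᵀΣy)) ) is the angle between Σ^{1/2}x and Σ^{1/2}y. (Closed form of the covariance arc-cosine kernel with rectified linear units.) -/

import Mathlib

open MeasureTheory Matrix Real

/-- The centered multivariate Gaussian measure `N(0, C)` on `ℝ^d` with symmetric positive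
definite covariance matrix `C`, given by its density w.r.t. Lebesgue measure. -/
noncomputable def gaussianMeasure {d : ℕ} (C : Matrix (Fin d) (Fin d) ℝ) :
    Measure (Fin d → ℝ) :=
  volume.withDensity fun w =>
    ENNReal.ofReal ((2 * π) ^ (-(d : ℝ) / 2) * C.det ^ (-(1 : ℝ) / 2) *
      Real.exp (-(w ⬝ᵥ (C⁻¹ *ᵥ w)) / 2))

open ProbabilityTheory

/-- The substitution `w = S z` turns `N(0, S * S)` into the standard Gaussian density. -/
lemma integral_gaussianMeasure {E : Type*} [NormedAddCommGroup E] [NormedSpace ℝ E] {d : ℕ}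
    {S : Matrix (Fin d) (Fin d) ℝ} (hS : S.PosDef) (hSsymm : S.IsSymm) (f : (Fin d → ℝ) → E) :
    ∫ w, f w ∂(gaussianMeasure (S * S)) =
      ∫ z, ((2 * π) ^ (-(d : ℝ) / 2) * Real.exp (-(z ⬝ᵥ z) / 2)) • f (S *ᵥ z) := by
  have hdet : 0 < S.det := hS.det_pos
  have hunit : IsUnit S.det := hdet.ne'.isUnit
  have hC : (S * S).det ^ (-(1 : ℝ) / 2) = S.det⁻¹ := by
    rw [det_mul, ← sq, ← Real.rpow_natCast, ← Real.rpow_mul hdet.le]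
    norm_num
    exact Real.rpow_neg_one _
  have hquad (z : Fin d → ℝ) : (S *ᵥ z) ⬝ᵥ ((S * S)⁻¹ *ᵥ (S *ᵥ z)) = z ⬝ᵥ z := by
    rw [Matrix.mul_inv_rev, mulVec_mulVec, Matrix.mul_assoc, nonsing_inv_mul _ hunit, Matrix.mul_one,
      ← vecMul_transpose, hSsymm.eq, ← dotProduct_mulVec, mulVec_mulVec, mul_nonsing_inv _ hunit,
      one_mulVec]
  have hmeas : Measurable fun w : Fin d → ℝ =>
      (2 * π) ^ (-(d : ℝ) / 2) * (S * S).det ^ (-(1 : ℝ) / 2) *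
        Real.exp (-(w ⬝ᵥ ((S * S)⁻¹ *ᵥ w)) / 2) := by
    refine Continuous.measurable ?_
    unfold Matrix.mulVec dotProduct
    fun_prop
  have hemb : MeasurableEmbedding (toLin' S) := by
    have : Function.Injective (toLin' S) := by
      intro u v h
      exact mulVec_injective_iff_isUnit.mpr ((isUnit_iff_isUnit_det S).mpr hunit) h
    exact (toLin' S).continuous_of_finiteDimensional.measurableEmbedding this
  have hpos : 0 ≤ (2 * π) ^ (-(d : ℝ) / 2) * S.det⁻¹ := by positivity
  unfold gaussianMeasure
  rw [integral_withDensity_eq_integral_toReal_smul hmeas.ennreal_ofReal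
    (ae_of_all _ fun _ => ENNReal.ofReal_lt_top)]
  rw [hC]
  have key := hemb.integral_map (μ := volume) fun w : Fin d → ℝ =>
    ((2 * π) ^ (-(d : ℝ) / 2) * Real.exp (-(w ⬝ᵥ ((S * S)⁻¹ *ᵥ w)) / 2)) • f w
  rw [Real.map_matrix_volume_pi_eq_smul_volume_pi hdet.ne', integral_smul_measure,
    ENNReal.toReal_ofReal (abs_nonneg _), abs_of_pos (inv_pos.mpr hdet), ← integral_smul] at key
  simp only [toLin'_apply, hquad] at key
  rw [← key]
  refine integral_congr_ae (ae_of_all _ fun w => ?_)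
  dsimp only
  rw [ENNReal.toReal_ofReal (by positivity), smul_smul]
  congr 1
  ring

lemma integral_cexp_gaussianMeasure {d : ℕ}
    {S : Matrix (Fin d) (Fin d) ℝ} (hS : S.PosDef) (hSsymm : S.IsSymm) (t : Fin d → ℝ) :
    ∫ w, Complex.exp ((w ⬝ᵥ t : ℝ) * Complex.I) ∂(gaussianMeasure (S * S)) =
      Complex.exp (-(((S *ᵥ t) ⬝ᵥ (S *ᵥ t) : ℝ) / 2)) := by
  rw [integral_gaussianMeasure hS hSsymm]
  have h2 : (0 : ℝ) < ((1 / 2 : ℂ)).re := by norm_num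
  have key := GaussianFourier.integral_cexp_neg_mul_sum_add h2
    fun i : Fin d => (((S *ᵥ t) i : ℝ) : ℂ) * Complex.I
  have hint (z : Fin d → ℝ) :
      ((2 * π) ^ (-(d : ℝ) / 2) * Real.exp (-(z ⬝ᵥ z) / 2)) •
          Complex.exp (((S *ᵥ z) ⬝ᵥ t : ℝ) * Complex.I) =
        (((2 * π) ^ (-(d : ℝ) / 2) : ℝ) : ℂ) *
          Complex.exp (-(1 / 2) * ∑ i, (z i : ℂ) ^ 2 +
            ∑ i, (((S *ᵥ t) i : ℝ) : ℂ) * Complex.I * z i) := by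
    have h1 : (S *ᵥ z) ⬝ᵥ t = z ⬝ᵥ (S *ᵥ t) := by
      rw [← vecMul_transpose, hSsymm.eq, ← dotProduct_mulVec]
    rw [h1, Complex.real_smul, Complex.ofReal_mul, Complex.ofReal_exp, mul_assoc, ← Complex.exp_add]
    congr 3
    · simp only [dotProduct]
      push_cast
      rw [neg_div, neg_mul, one_div, div_eq_inv_mul]
      simp only [sq]
    · simp only [dotProduct]
      push_cast
      rw [Finset.sum_mul]
      exact Finset.sum_congr rfl fun i _ => by ring
  simp_rw [hint]
  rw [integral_const_mul, key, ← mul_assoc]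
  have hc : (((2 * π) ^ (-(d : ℝ) / 2) : ℝ) : ℂ) *
      ((π : ℂ) / (1 / 2)) ^ (Fintype.card (Fin d) / 2 : ℂ) = 1 := by
    have : ((π : ℂ) / (1 / 2)) ^ (Fintype.card (Fin d) / 2 : ℂ) =
        (((2 * π) ^ ((d : ℝ) / 2) : ℝ) : ℂ) := by
      rw [Complex.ofReal_cpow (by positivity)]
      simp
      ring_nf
    rw [this, ← Complex.ofReal_mul, ← Real.rpow_add (by positivity)]
    ring_nf
    simp
  rw [hc, one_mul]
  congr 1
  simp only [dotProduct, mul_pow, Complex.I_sq]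
  push_cast
  rw [Finset.sum_div, Finset.sum_div, ← Finset.sum_neg_distrib]
  exact Finset.sum_congr rfl fun i _ => by ring

lemma isProbabilityMeasure_gaussianMeasure {d : ℕ}
    {S : Matrix (Fin d) (Fin d) ℝ} (hS : S.PosDef) (hSsymm : S.IsSymm) :
    IsProbabilityMeasure (gaussianMeasure (S * S)) := by
  have h := integral_cexp_gaussianMeasure hS hSsymm 0
  simp at h
  constructor
  rwa [measureReal_def, ENNReal.toReal_eq_one_iff] at h

/-- The joint law of two linear functionals of a centered Gaussian vector only depends on their
Gram matrix. -/
lemma integral_gaussianMeasure_congr {d e : ℕ}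
    {S : Matrix (Fin d) (Fin d) ℝ} (hS : S.PosDef) (hSsymm : S.IsSymm)
    {T : Matrix (Fin e) (Fin e) ℝ} (hT : T.PosDef) (hTsymm : T.IsSymm)
    {x y : Fin d → ℝ} {u v : Fin e → ℝ}
    (hxx : (S *ᵥ x) ⬝ᵥ (S *ᵥ x) = (T *ᵥ u) ⬝ᵥ (T *ᵥ u))
    (hxy : (S *ᵥ x) ⬝ᵥ (S *ᵥ y) = (T *ᵥ u) ⬝ᵥ (T *ᵥ v))
    (hyy : (S *ᵥ y) ⬝ᵥ (S *ᵥ y) = (T *ᵥ v) ⬝ᵥ (T *ᵥ v))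
    {g : ℝ → ℝ → ℝ} (hg : Measurable (Function.uncurry g)) :
    ∫ w, g (w ⬝ᵥ x) (w ⬝ᵥ y) ∂(gaussianMeasure (S * S)) =
      ∫ w, g (w ⬝ᵥ u) (w ⬝ᵥ v) ∂(gaussianMeasure (T * T)) := by
  have := isProbabilityMeasure_gaussianMeasure hS hSsymm
  have := isProbabilityMeasure_gaussianMeasure hT hTsymm
  have hmeas {n : ℕ} (p q : Fin n → ℝ) :
      Measurable fun w : Fin n → ℝ => (!₂[w ⬝ᵥ p, w ⬝ᵥ q] : EuclideanSpace ℝ (Fin 2)) := by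
    refine Continuous.measurable ?_
    unfold dotProduct
    fun_prop
  have hchar {n : ℕ} {R : Matrix (Fin n) (Fin n) ℝ} (hR : R.PosDef) (hRsymm : R.IsSymm)
      (p q : Fin n → ℝ) (t : EuclideanSpace ℝ (Fin 2)) :
      charFun ((gaussianMeasure (R * R)).map
        fun w => (!₂[w ⬝ᵥ p, w ⬝ᵥ q] : EuclideanSpace ℝ (Fin 2))) t =
      Complex.exp (-((t 0 ^ 2 * ((R *ᵥ p) ⬝ᵥ (R *ᵥ p)) + 2 * t 0 * t 1 * ((R *ᵥ p) ⬝ᵥ (R *ᵥ q)) +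
        t 1 ^ 2 * ((R *ᵥ q) ⬝ᵥ (R *ᵥ q)) : ℝ) / 2)) := by
    rw [charFun_apply, integral_map (hmeas p q).aemeasurable
      (Measurable.aestronglyMeasurable (by fun_prop))]
    have h1 (w : Fin n → ℝ) : inner ℝ (!₂[w ⬝ᵥ p, w ⬝ᵥ q] : EuclideanSpace ℝ (Fin 2)) t =
        w ⬝ᵥ (t 0 • p + t 1 • q) := by
      simp [PiLp.inner_apply, Fin.sum_univ_two, dotProduct_add, dotProduct_smul]
    simp_rw [h1]
    rw [integral_cexp_gaussianMeasure hR hRsymm]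
    congr 4
    simp only [mulVec_add, mulVec_smul, add_dotProduct, dotProduct_add, smul_dotProduct,
      dotProduct_smul, smul_eq_mul]
    rw [dotProduct_comm (R *ᵥ q) (R *ᵥ p)]
    ring
  have hlaw : (gaussianMeasure (S * S)).map
        (fun w => (!₂[w ⬝ᵥ x, w ⬝ᵥ y] : EuclideanSpace ℝ (Fin 2))) =
      (gaussianMeasure (T * T)).map
        fun w => (!₂[w ⬝ᵥ u, w ⬝ᵥ v] : EuclideanSpace ℝ (Fin 2)) := by
    refine Measure.ext_of_charFun (funext fun t => ?_)
    rw [hchar hS hSsymm, hchar hT hTsymm, hxx, hxy, hyy]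
  have hgm : Measurable fun p : EuclideanSpace ℝ (Fin 2) => g (p 0) (p 1) :=
    hg.comp (f := fun p : EuclideanSpace ℝ (Fin 2) => (p 0, p 1)) (by fun_prop)
  have h := congrArg (fun μ => ∫ p, g (p 0) (p 1) ∂μ) hlaw
  dsimp only at h
  rw [integral_map (hmeas x y).aemeasurable hgm.aestronglyMeasurable,
    integral_map (hmeas u v).aemeasurable hgm.aestronglyMeasurable] at h
  simpa using h

lemma integral_max_cos_mul_max_cos {θ : ℝ} (h0 : 0 ≤ θ) (hπ : θ ≤ π) :
    ∫ φ in Set.Ioo (-π) π, max (cos φ) 0 * max (cos (φ - θ)) 0 =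
      (sin θ + (π - θ) * cos θ) / 2 := by
  have hind : ∀ φ ∈ Set.Ioo (-π) π, max (cos φ) 0 * max (cos (φ - θ)) 0 =
      (Set.Ioc (θ - π / 2) (π / 2)).indicator (fun φ => cos φ * cos (φ - θ)) φ := by
    rintro φ ⟨h1, h2⟩
    by_cases h : φ ∈ Set.Ioc (θ - π / 2) (π / 2)
    · rw [Set.indicator_of_mem h, max_eq_left, max_eq_left]
      · exact cos_nonneg_of_mem_Icc ⟨by linarith [h.1], by linarith [h.2]⟩
      · exact cos_nonneg_of_mem_Icc ⟨by linarith [h.1], by linarith [h.2]⟩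
    · rw [Set.indicator_of_notMem h]
      rw [Set.mem_Ioc, not_and_or, not_lt, not_le] at h
      have hcos (ψ : ℝ) (ha : π / 2 ≤ ψ) (hb : ψ ≤ 3 * π / 2) : cos ψ ≤ 0 :=
        cos_nonpos_of_pi_div_two_le_of_le ha (by linarith)
      rcases h with h | h
      · by_cases h' : θ - 3 * π / 2 ≤ φ
        · rw [max_eq_right (a := cos (φ - θ)), mul_zero]
          rw [← cos_neg]
          exact hcos _ (by linarith) (by linarith)
        · rw [max_eq_right (a := cos φ), zero_mul]
          rw [← cos_neg]
          exact hcos _ (by linarith) (by linarith)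
      · rw [max_eq_right (a := cos φ), zero_mul]
        exact hcos _ h.le (by linarith)
  rw [setIntegral_congr_fun measurableSet_Ioo hind, setIntegral_indicator measurableSet_Ioc]
  have hpi := pi_pos
  have hae : (Set.Ioo (-π) π ∩ Set.Ioc (θ - π / 2) (π / 2) : Set ℝ) =
      Set.Ioc (θ - π / 2) (π / 2) :=
    Set.inter_eq_right.mpr fun φ h => ⟨by linarith [h.1], by linarith [h.2]⟩
  rw [hae, ← intervalIntegral.integral_of_le (by linarith)]
  have hderiv : ∀ φ ∈ Set.uIcc (θ - π / 2) (π / 2),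
      HasDerivAt (fun φ => (φ * cos θ + sin (2 * φ - θ) / 2) / 2) (cos φ * cos (φ - θ)) φ := by
    intro φ _
    have h := (((hasDerivAt_id φ).mul_const (cos θ)).add
      ((((hasDerivAt_id φ).const_mul 2).sub_const θ).sin.div_const 2)).div_const 2
    refine h.congr_deriv ?_
    have h1 : cos (2 * φ - θ) = cos φ * cos (φ - θ) - sin φ * sin (φ - θ) := by
      rw [← cos_add]; ring_nf
    have h2 : cos θ = cos φ * cos (φ - θ) + sin φ * sin (φ - θ) := by
      rw [← cos_sub]; ring_nf
    rw [id, h1]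
    linarith
  rw [intervalIntegral.integral_eq_sub_of_hasDerivAt hderiv
    (Continuous.intervalIntegrable (by fun_prop) _ _)]
  have h1 : sin (2 * (π / 2) - θ) = sin θ := by
    rw [mul_div_cancel₀ _ two_ne_zero, sin_pi_sub]
  have h2 : sin (2 * (θ - π / 2) - θ) = -sin θ := by
    rw [show 2 * (θ - π / 2) - θ = θ - π by ring, sin_sub_pi]
  rw [h1, h2]
  ring

lemma integral_pow_three_mul_exp_neg_sq_div_two :
    ∫ r in Set.Ioi (0 : ℝ), r ^ 3 * Real.exp (-r ^ 2 / 2) = 2 := by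
  have h := integral_rpow_mul_exp_neg_mul_rpow (p := 2) (q := 3) (b := 1 / 2)
    (by norm_num) (by norm_num) (by norm_num)
  norm_num [Real.Gamma_two, Real.rpow_neg] at h
  refine Eq.trans (setIntegral_congr_fun measurableSet_Ioi fun r _ => ?_) h
  ring_nf

lemma integral_relu_mul_relu_gaussianMeasure_one {α β θ : ℝ} (hα : 0 ≤ α) (hβ : 0 ≤ β)
    (h0 : 0 ≤ θ) (hπ : θ ≤ π) :
    ∫ w, max (w ⬝ᵥ ![α, 0]) 0 * max (w ⬝ᵥ ![β * cos θ, β * sin θ]) 0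
      ∂(gaussianMeasure ((1 : Matrix (Fin 2) (Fin 2) ℝ) * 1)) =
      1 / (2 * π) * α * β * (sin θ + (π - θ) * cos θ) := by
  rw [integral_gaussianMeasure PosDef.one isSymm_one]
  have key := (volume_preserving_finTwoArrow ℝ).integral_comp'
    (fun p : ℝ × ℝ => ((2 * π)⁻¹ * Real.exp (-(p.1 ^ 2 + p.2 ^ 2) / 2)) *
      (max (α * p.1) 0 * max (β * (cos θ * p.1 + sin θ * p.2)) 0))
  rw [← integral_comp_polarCoord_symm, polarCoord_target, Measure.volume_eq_prod] at key
  have hpolar : ∀ p ∈ Set.Ioi (0 : ℝ) ×ˢ Set.Ioo (-π) π,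
      p.1 • (((2 * π)⁻¹ * Real.exp (-((polarCoord.symm p).1 ^ 2 + (polarCoord.symm p).2 ^ 2) / 2)) *
        (max (α * (polarCoord.symm p).1) 0 *
          max (β * (cos θ * (polarCoord.symm p).1 + sin θ * (polarCoord.symm p).2)) 0)) =
      ((2 * π)⁻¹ * α * β * (p.1 ^ 3 * Real.exp (-p.1 ^ 2 / 2))) *
        (max (cos p.2) 0 * max (cos (p.2 - θ)) 0) := by
    rintro ⟨r, φ⟩ ⟨hr, -⟩
    have hr : 0 < r := hr
    simp only [polarCoord_symm_apply, smul_eq_mul]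
    have h1 : (r * cos φ) ^ 2 + (r * sin φ) ^ 2 = r ^ 2 := by
      rw [mul_pow, mul_pow, ← mul_add, cos_sq_add_sin_sq, mul_one]
    have h2 : max (α * (r * cos φ)) 0 = α * r * max (cos φ) 0 := by
      rw [← mul_assoc, mul_max_of_nonneg _ _ (by positivity), mul_zero]
    have h3 : max (β * (cos θ * (r * cos φ) + sin θ * (r * sin φ))) 0 =
        β * r * max (cos (φ - θ)) 0 := by
      rw [mul_max_of_nonneg _ _ (by positivity), mul_zero, cos_sub]
      ring_nf
    rw [h1, h2, h3]
    ring
  rw [setIntegral_congr_fun (measurableSet_Ioi.prod measurableSet_Ioo) hpolar,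
    setIntegral_prod_mul (fun r : ℝ => (2 * π)⁻¹ * α * β * (r ^ 3 * Real.exp (-r ^ 2 / 2)))
      (fun φ : ℝ => max (cos φ) 0 * max (cos (φ - θ)) 0), integral_const_mul,
    integral_pow_three_mul_exp_neg_sq_div_two, integral_max_cos_mul_max_cos h0 hπ] at key
  calc _ = _ := integral_congr_ae (ae_of_all _ fun z => ?_)
    _ = _ := key
    _ = _ := by ring
  have hexp : (2 * π) ^ (-((2 : ℕ) : ℝ) / 2) = (2 * π)⁻¹ := by
    rw [show -((2 : ℕ) : ℝ) / 2 = -1 by norm_num, Real.rpow_neg_one]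
  rw [hexp]
  simp only [MeasurableEquiv.finTwoArrow_apply, one_mulVec, dotProduct, Fin.sum_univ_two,
    smul_eq_mul, cons_val_zero, cons_val_one]
  ring_nf

lemma dotProduct_sq_le {d : ℕ} (a b : Fin d → ℝ) :
    (a ⬝ᵥ b) ^ 2 ≤ (a ⬝ᵥ a) * (b ⬝ᵥ b) := by
  simpa [dotProduct, sq] using Finset.sum_mul_sq_le_sq_mul_sq Finset.univ a b

/-- **Closed form of the covariance arc-cosine kernel with rectified linear units.**
For nonzero `x, y ∈ ℝ^d` and `w ∼ N(0, C)` with `C = S * S`, `S` the symmetric positive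
definite square root of `C`,
`E[(wᵀx)₊ (wᵀy)₊] = (1/(2π)) ‖Sx‖ ‖Sy‖ (sin θ + (π - θ) cos θ)`
where `θ = arccos(xᵀC y / √((xᵀC x)(yᵀC y)))` is the angle between `Sx` and `Sy`. -/
theorem statement5 {d : ℕ} (hd : 1 ≤ d) (C S : Matrix (Fin d) (Fin d) ℝ)
    (hC : C.PosDef) (hS : S.PosDef) (hSsymm : S.IsSymm) (hSS : S * S = C)
    (x y : Fin d → ℝ) (hx : x ≠ 0) (hy : y ≠ 0) :
    ∫ w, max (w ⬝ᵥ x) 0 * max (w ⬝ᵥ y) 0 ∂(gaussianMeasure C) =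
      (1 / (2 * π)) * Real.sqrt ((S *ᵥ x) ⬝ᵥ (S *ᵥ x)) * Real.sqrt ((S *ᵥ y) ⬝ᵥ (S *ᵥ y)) *
        (Real.sin (Real.arccos ((x ⬝ᵥ (C *ᵥ y)) /
            Real.sqrt ((x ⬝ᵥ (C *ᵥ x)) * (y ⬝ᵥ (C *ᵥ y))))) +
          (π - Real.arccos ((x ⬝ᵥ (C *ᵥ y)) /
            Real.sqrt ((x ⬝ᵥ (C *ᵥ x)) * (y ⬝ᵥ (C *ᵥ y))))) *
            Real.cos (Real.arccos ((x ⬝ᵥ (C *ᵥ y)) /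
              Real.sqrt ((x ⬝ᵥ (C *ᵥ x)) * (y ⬝ᵥ (C *ᵥ y)))))) := by
  subst hSS
  have hCS (p q : Fin d → ℝ) : p ⬝ᵥ ((S * S) *ᵥ q) = (S *ᵥ p) ⬝ᵥ (S *ᵥ q) := by
    rw [← mulVec_mulVec, dotProduct_mulVec, ← mulVec_transpose, hSsymm.eq]
  have hpos {p : Fin d → ℝ} (hp : p ≠ 0) : 0 < (S *ᵥ p) ⬝ᵥ (S *ᵥ p) := by
    rw [← hCS]
    simpa using hC.dotProduct_mulVec_pos hp
  have ha := hpos hx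
  have hb := hpos hy
  have hcs := dotProduct_sq_le (S *ᵥ x) (S *ᵥ y)
  simp only [hCS]
  generalize hA : (S *ᵥ x) ⬝ᵥ (S *ᵥ x) = A at *
  generalize hB : (S *ᵥ y) ⬝ᵥ (S *ᵥ y) = B at *
  generalize hG : (S *ᵥ x) ⬝ᵥ (S *ᵥ y) = G at *
  have habs : |G| ≤ √(A * B) := Real.abs_le_sqrt hcs
  have hAB : 0 < √(A * B) := Real.sqrt_pos.mpr (mul_pos ha hb)
  have hcos : cos (arccos (G / √(A * B))) = G / √(A * B) :=
    Real.cos_arccos (by rw [le_div_iff₀ hAB]; linarith [neg_le_of_abs_le habs])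
      (by rw [div_le_one hAB]; exact le_of_abs_le habs)
  set θ := arccos (G / √(A * B)) with hθ
  rw [← integral_relu_mul_relu_gaussianMeasure_one (Real.sqrt_nonneg A) (Real.sqrt_nonneg B)
    (Real.arccos_nonneg _) (Real.arccos_le_pi _)]
  refine integral_gaussianMeasure_congr hS hSsymm PosDef.one isSymm_one ?_ ?_ ?_
    (g := fun s t => max s 0 * max t 0) ?_
  · simp [hA, ha.le]
  · simp only [one_mulVec, dotProduct, Fin.sum_univ_two, cons_val_zero, cons_val_one, zero_mul,
      add_zero] at hG ⊢
    rw [hG, ← hθ, hcos, ← mul_assoc, ← Real.sqrt_mul ha.le, mul_div_cancel₀ _ hAB.ne']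
  · rw [← hθ, hB]
    simp only [one_mulVec, dotProduct, Fin.sum_univ_two, cons_val_zero, cons_val_one]
    linear_combination (-√B ^ 2) * sin_sq_add_cos_sq θ - Real.sq_sqrt hb.le
  · unfold Function.uncurry
    fun_prop
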